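/- Let S be a subordinator with Laplace exponent φ and let L_t = inf{r > 0 : S_r > t} be its inverse. Then for every p > 0 and λ > 0, ∫_0^∞ e^{-λ t} E[L_t^p] dt = Γ(p+1)/(λ φ(λ)^p), where Γ is the Gamma function. -/

import Mathlib

open MeasureTheory Real Set

/-- The measure with density `e^{-λ t}` on `(0, ∞)`. -/
noncomputable def expWeight (lam : ℝ) : Measure ℝ :=
  (volume.restrict (Ioi 0)).withDensity fun t => ENNReal.ofReal (Real.exp (-(lam * t)))

instance (lam : ℝ) : SFinite (expWeight lam) := by
  unfold expWeight; infer_instance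

theorem expWeight_Ici {lam s : ℝ} (hlam : 0 < lam) (hs : 0 ≤ s) :
    expWeight lam (Ici s) = ENNReal.ofReal (Real.exp (-(lam * s)) / lam) := by
  have hIoi : expWeight lam (Ici s) = expWeight lam (Ioi s) :=
    measure_congr ((withDensity_absolutelyContinuous _ _).ae_eq Ioi_ae_eq_Ici.symm)
  have hint := integrableOn_exp_mul_Ioi (neg_lt_zero.mpr hlam) s
  rw [hIoi, expWeight, withDensity_apply _ measurableSet_Ioi,
    Measure.restrict_restrict measurableSet_Ioi, Ioi_inter_Ioi, sup_of_le_left hs]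
  simp only [← neg_mul]
  rw [← ofReal_integral_eq_lintegral_ofReal hint (ae_of_all _ fun _ => (Real.exp_pos _).le),
    integral_exp_mul_Ioi (neg_lt_zero.mpr hlam), neg_div_neg_eq]

theorem ae_pos_expWeight (lam : ℝ) : ∀ᵐ t ∂expWeight lam, 0 < t :=
  (withDensity_absolutelyContinuous _ _).ae_le (ae_restrict_mem measurableSet_Ioi)

theorem integral_expWeight (lam : ℝ) (f : ℝ → ℝ) :
    ∫ t, f t ∂expWeight lam = ∫ t in Ioi 0, Real.exp (-(lam * t)) * f t := by
  rw [expWeight, integral_withDensity_eq_integral_toReal_smul (by fun_prop)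
    (ae_of_all _ fun _ => ENNReal.ofReal_lt_top)]
  simp [ENNReal.toReal_ofReal (Real.exp_pos _).le]

/-- Moments of a function whose tail is sandwiched by an exponential. -/
theorem lintegral_rpow_of_exponential_tail {α : Type*} [MeasurableSpace α] {μ : Measure α}
    {X : α → ℝ} (hX : AEMeasurable X μ) (hX0 : 0 ≤ X) {a c p : ℝ} (ha : 0 < a) (hc : 0 < c)
    (hp : 0 < p)
    (hlt : ∀ r > 0, μ {x | r < X x} ≤ ENNReal.ofReal (Real.exp (-(a * r)) / c))
    (hle : ∀ r > 0, ENNReal.ofReal (Real.exp (-(a * r)) / c) ≤ μ {x | r ≤ X x}) :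
    ∫⁻ x, ENNReal.ofReal (X x ^ p) ∂μ = ENNReal.ofReal (Real.Gamma (p + 1) / (c * a ^ p)) := by
  have hnn : ∀ r ∈ Ioi (0 : ℝ), 0 ≤ r ^ (p - 1) * Real.exp (-(a * r)) := fun r hr =>
    mul_nonneg (Real.rpow_nonneg (le_of_lt hr) _) (Real.exp_pos _).le
  have hint : IntegrableOn (fun r : ℝ => r ^ (p - 1) * Real.exp (-(a * r))) (Ioi 0) := by
    simpa using integrableOn_rpow_mul_exp_neg_mul_rpow (p := 1) (s := p - 1) (b := a)
      (by linarith) one_pos ha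
  have hval : ENNReal.ofReal p * ∫⁻ r in Ioi (0 : ℝ), ENNReal.ofReal (Real.exp (-(a * r)) / c)
      * ENNReal.ofReal (r ^ (p - 1)) = ENNReal.ofReal (Real.Gamma (p + 1) / (c * a ^ p)) := by
    have hcongr : ∫⁻ r in Ioi (0 : ℝ), ENNReal.ofReal (Real.exp (-(a * r)) / c)
        * ENNReal.ofReal (r ^ (p - 1))
        = ∫⁻ r in Ioi (0 : ℝ), ENNReal.ofReal (r ^ (p - 1) * Real.exp (-(a * r)) / c) := by
      refine lintegral_congr fun r => ?_
      rw [← ENNReal.ofReal_mul (by positivity)]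
      congr 1
      ring
    rw [hcongr, ← ofReal_integral_eq_lintegral_ofReal (hint.div_const c)
      ((ae_restrict_mem measurableSet_Ioi).mono fun r hr => div_nonneg (hnn r hr) hc.le),
      integral_div, integral_rpow_mul_exp_neg_mul_Ioi hp ha, ← ENNReal.ofReal_mul hp.le,
      Real.Gamma_add_one hp.ne', Real.div_rpow zero_le_one ha.le, Real.one_rpow]
    congr 1
    field_simp
  refine le_antisymm ?_ ?_
  · rw [lintegral_rpow_eq_lintegral_meas_lt_mul μ (ae_of_all _ hX0) hX hp, ← hval]
    gcongr ENNReal.ofReal p * ?_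
    exact setLIntegral_mono' measurableSet_Ioi fun r hr => by gcongr; exact hlt r hr
  · rw [lintegral_rpow_eq_lintegral_meas_le_mul μ (ae_of_all _ hX0) hX hp, ← hval]
    gcongr ENNReal.ofReal p * ?_
    exact setLIntegral_mono' measurableSet_Ioi fun r hr => by gcongr; exact hle r hr

/-- A sequence whose Laplace transforms tend to zero is almost surely unbounded above. -/
theorem ae_forall_exists_lt_of_tendsto_integral_exp_neg {Ω : Type*} [MeasurableSpace Ω]
    {P : Measure Ω} {X : ℕ → Ω → ℝ} (hX : ∀ n, Measurable (X n))
    (hint : ∀ n, Integrable (fun ω => Real.exp (-X n ω)) P)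
    (hlim : Filter.Tendsto (fun n => ∫ ω, Real.exp (-X n ω) ∂P) Filter.atTop (nhds 0)) :
    ∀ᵐ ω ∂P, ∀ t, ∃ n, t < X n ω := by
  have hzero : ∫⁻ ω, ⨅ n, ENNReal.ofReal (Real.exp (-X n ω)) ∂P = 0 := by
    refine le_antisymm (ge_of_tendsto' (by simpa using ENNReal.tendsto_ofReal hlim) fun n => ?_)
      zero_le
    rw [ofReal_integral_eq_lintegral_ofReal (hint n) (ae_of_all _ fun _ => (Real.exp_pos _).le)]
    exact lintegral_mono fun ω => iInf_le _ n
  rw [lintegral_eq_zero_iff (by fun_prop)] at hzero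
  filter_upwards [hzero] with ω hω t
  have hlt : ⨅ n, ENNReal.ofReal (Real.exp (-X n ω)) < ENNReal.ofReal (Real.exp (-t)) := by
    rw [hω]
    simpa using Real.exp_pos (-t)
  obtain ⟨n, hn⟩ := iInf_lt_iff.mp hlt
  rw [ENNReal.ofReal_lt_ofReal_iff (Real.exp_pos _), Real.exp_lt_exp] at hn
  exact ⟨n, by linarith⟩

section FirstPassage

variable {f : ℝ → ℝ} {t : ℝ}

theorem bddBelow_firstPassage : BddBelow {r : ℝ | 0 < r ∧ t < f r} := ⟨0, fun _ hr => hr.1.le⟩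

theorem firstPassage_nonneg : 0 ≤ sInf {r : ℝ | 0 < r ∧ t < f r} :=
  Real.sInf_nonneg fun _ hr => hr.1.le

theorem le_of_lt_firstPassage {r : ℝ} (hr : 0 < r) (h : r < sInf {r : ℝ | 0 < r ∧ t < f r}) :
    f r ≤ t := by
  by_contra! hlt
  exact absurd (csInf_le bddBelow_firstPassage ⟨hr, hlt⟩) h.not_ge

theorem le_firstPassage (hf : Monotone f) (hne : ∃ r > 0, t < f r) {r : ℝ} (h : f r ≤ t) :
    r ≤ sInf {r : ℝ | 0 < r ∧ t < f r} := by
  refine le_csInf hne fun s hs => ?_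
  by_contra! hlt
  exact absurd (hf hlt.le) (h.trans_lt hs.2).not_ge

theorem firstPassage_eq_iInf_rat (hf : Monotone f) (hne : ∃ r > 0, t < f r) :
    sInf {r : ℝ | 0 < r ∧ t < f r}
      = (⨅ q : ℚ, if 0 < (q : ℝ) ∧ t < f q then ENNReal.ofReal q else ⊤).toReal := by
  rw [← ENNReal.toReal_ofReal (firstPassage_nonneg (f := f) (t := t))]
  congr 1
  refine le_antisymm (le_iInf fun q => ?_) (le_of_forall_gt fun b hb => ?_)
  · split_ifs with hq
    · exact ENNReal.ofReal_le_ofReal (csInf_le bddBelow_firstPassage hq)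
    · exact le_top
  · obtain ⟨x, hx, hxb⟩ : ∃ x : ℝ, sInf {r : ℝ | 0 < r ∧ t < f r} < x ∧ ENNReal.ofReal x ≤ b := by
      by_cases hbt : b = ⊤
      · exact ⟨_, lt_add_one _, hbt ▸ le_top⟩
      · exact ⟨b.toReal, (ENNReal.ofReal_lt_iff_lt_toReal firstPassage_nonneg hbt).mp hb,
          ENNReal.ofReal_toReal_le⟩
    obtain ⟨r, hr, hrx⟩ := exists_lt_of_csInf_lt hne hx
    obtain ⟨q, hrq, hqx⟩ := exists_rat_btwn hrx
    have hq : 0 < (q : ℝ) ∧ t < f q := ⟨hr.1.trans hrq, hr.2.trans_le (hf hrq.le)⟩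
    refine lt_of_lt_of_le (lt_of_le_of_lt (iInf_le _ q) ?_) hxb
    rw [if_pos hq]
    exact (ENNReal.ofReal_lt_ofReal_iff (hq.1.trans hqx)).mpr hqx

end FirstPassage

/-- If `S` is a subordinator with Laplace exponent `φ` and
`L_t = inf {r > 0 : S_r > t}` is its inverse, then for all `p > 0` and `λ > 0`,
`∫_0^∞ e^{-λ t} E[L_t^p] dt = Γ(p+1) / (λ φ(λ)^p)`. -/
theorem stmt1 {Ω : Type*} [MeasurableSpace Ω] (P : Measure Ω) [IsProbabilityMeasure P]
    (S : ℝ → Ω → ℝ) (φ : ℝ → ℝ)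
    (hSmeas : ∀ r, Measurable (S r))
    (hS0 : ∀ᵐ ω ∂P, S 0 ω = 0)
    (hSmono : ∀ᵐ ω ∂P, Monotone fun r => S r ω)
    (hLap : ∀ lam > (0 : ℝ), ∀ r ≥ (0 : ℝ),
      ∫ ω, Real.exp (-(lam * S r ω)) ∂P = Real.exp (-(r * φ lam)))
    (hφpos : ∀ lam > (0 : ℝ), 0 < φ lam)
    (L : ℝ → Ω → ℝ)
    (hL : ∀ t ω, L t ω = sInf {r : ℝ | 0 < r ∧ t < S r ω}) :
    ∀ p > (0 : ℝ), ∀ lam > (0 : ℝ),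
      ∫ t in Set.Ioi (0 : ℝ), Real.exp (-(lam * t)) * (∫ ω, L t ω ^ p ∂P)
        = Real.Gamma (p + 1) / (lam * φ lam ^ p) := by
  intro p hp lam hlam
  have hexpint : ∀ b > (0 : ℝ), ∀ r ≥ (0 : ℝ),
      Integrable (fun ω => Real.exp (-(b * S r ω))) P := fun b hb r hr =>
    not_not.mp fun h => (Real.exp_pos _).ne ((integral_undef h).symm.trans (hLap b hb r hr))
  have hunbdd : ∀ᵐ ω ∂P, ∀ t, ∃ n : ℕ, t < S n ω := by
    refine ae_forall_exists_lt_of_tendsto_integral_exp_neg (fun n => hSmeas n)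
      (fun n => by simpa using hexpint 1 one_pos n n.cast_nonneg) ?_
    have heq : ∀ n : ℕ, ∫ ω, Real.exp (-S n ω) ∂P = Real.exp (-(n * φ 1)) := fun n => by
      simpa using hLap 1 one_pos n n.cast_nonneg
    simp only [heq]
    exact Real.tendsto_exp_neg_atTop_nhds_zero.comp
      (tendsto_natCast_atTop_atTop.atTop_mul_const (hφpos 1 one_pos))
  set ν := (expWeight lam).prod P with hν
  have hae : ∀ᵐ x ∂ν, Monotone (fun r => S r x.2) ∧ ∃ r > 0, x.1 < S r x.2 := by
    have hfst := Measure.quasiMeasurePreserving_fst (μ := expWeight lam) (ν := P)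
    have hsnd := Measure.quasiMeasurePreserving_snd (μ := expWeight lam) (ν := P)
    filter_upwards [hfst.ae (ae_pos_expWeight lam), hsnd.ae hSmono, hsnd.ae hS0,
      hsnd.ae hunbdd] with x hx hmono h0 hub
    obtain ⟨n, hn⟩ := hub x.1
    refine ⟨hmono, n, ?_, hn⟩
    by_contra! hle
    have := hmono hle
    simp only at this
    linarith
  have hLmeas : AEMeasurable (fun x : ℝ × Ω => L x.1 x.2) ν := by
    refine ⟨fun x => (⨅ q : ℚ, if 0 < (q : ℝ) ∧ x.1 < S q x.2 then ENNReal.ofReal q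
      else ⊤).toReal, ?_, ?_⟩
    · refine (Measurable.iInf fun q => Measurable.ite ?_ measurable_const
        measurable_const).ennreal_toReal
      exact (MeasurableSet.const _).inter
        (measurableSet_lt measurable_fst ((hSmeas q).comp measurable_snd))
    · filter_upwards [hae] with x hx
      rw [hL, firstPassage_eq_iInf_rat hx.1 hx.2]
  have htail : ∀ r > 0, ν {x | S r x.2 ≤ x.1}
      = ENNReal.ofReal (Real.exp (-(φ lam * r)) / lam) := by
    intro r hr
    have hset : MeasurableSet {x : ℝ × Ω | S r x.2 ≤ x.1} :=
      measurableSet_le ((hSmeas r).comp measurable_snd) measurable_fst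
    rw [hν, Measure.prod_apply_symm hset, mul_comm,
      ← hLap lam hlam r hr.le, ← integral_div,
      ofReal_integral_eq_lintegral_ofReal ((hexpint lam hlam r hr.le).div_const lam)
        (ae_of_all _ fun _ => by positivity)]
    refine lintegral_congr_ae ?_
    filter_upwards [hSmono, hS0] with ω hmono h0
    exact expWeight_Ici hlam (h0.ge.trans (hmono hr.le))
  have hL0 : ∀ x : ℝ × Ω, 0 ≤ L x.1 x.2 := fun x => hL x.1 x.2 ▸ firstPassage_nonneg
  have hmoment := lintegral_rpow_of_exponential_tail hLmeas hL0 (hφpos lam hlam) hlam hp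
    (fun r hr => htail r hr ▸ measure_mono fun x (hx : r < L x.1 x.2) =>
      le_of_lt_firstPassage hr (hL x.1 x.2 ▸ hx))
    (fun r hr => htail r hr ▸ measure_mono_ae (by
      filter_upwards [hae] with x hx hle
      exact (le_firstPassage hx.1 hx.2 hle).trans_eq (hL x.1 x.2).symm))
  have hnn : 0 ≤ᵐ[ν] fun x => L x.1 x.2 ^ p := ae_of_all _ fun x => Real.rpow_nonneg (hL0 x) p
  have hsm : AEStronglyMeasurable (fun x : ℝ × Ω => L x.1 x.2 ^ p) ν :=
    (hLmeas.pow_const p).aestronglyMeasurable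
  have hint : Integrable (fun x : ℝ × Ω => L x.1 x.2 ^ p) ν :=
    ⟨hsm, (hasFiniteIntegral_iff_ofReal hnn).mpr (hmoment ▸ ENNReal.ofReal_lt_top)⟩
  rw [← integral_expWeight, ← integral_prod _ hint, integral_eq_lintegral_of_nonneg_ae hnn hsm,
    hmoment, ENNReal.toReal_ofReal]
  have := hφpos lam hlam
  have := Real.Gamma_pos_of_pos (add_pos hp one_pos)
  positivity
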